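/- Let g : ℝ^d → ℝ be L-Lipschitz, let Q be a probability measure on ℝ^d with finite second moment, fix T > 0, R > 0, and set C = L(1 + √2 ‖z‖_{L²(Q)}). Define ḡ_{t,x}(z) = g(e^{-t} x + (1-e^{-2t})^{1/2} z) - g(0) and the function class G = {ḡ_{t,x} : x ∈ B^d(R), t ∈ [0,T]} ⊆ L²(Q). If A is a finite subset of [0,T] × B^d(R) that is an ε-net of [0,T] × B^d(R) for the metric ρ_OU((t,x),(t',x')) = ‖e^{-t}x - e^{-t'}x'‖ + |t-t'|^{1/2} (i.e. every point of [0,T] × B^d(R) lies within ρ_OU-distance ε of some point of A), then {ḡ_{t,x} : (t,x) ∈ A} is a (Cε)-net of G in the L²(Q) norm. Consequently, the L²(Q) covering number satisfies N(G, L²(Q), Cε) ≤ N([0,T] × B^d(R), ρ_OU, ε). -/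

import Mathlib

open MeasureTheory Real
open scoped NNReal

/-- The covering number `N(A, ρ, ε)`: the smallest cardinality of a subset `S ⊆ A`
such that every point of `A` is within `ρ`-distance `ε` of some point of `S`. -/
noncomputable def coveringNumber {α : Type*} (A : Set α) (ρ : α → α → ℝ) (ε : ℝ) : ℕ∞ :=
  sInf {n : ℕ∞ | ∃ S : Set α, S ⊆ A ∧ S.encard = n ∧ ∀ a ∈ A, ∃ s ∈ S, ρ a s ≤ ε}

theorem coveringNumber_le_of_forall_mem_image {α β : Type*} {A : Set α} {B : Set β}
    {ρ : α → α → ℝ} {σ : β → β → ℝ} {ε δ : ℝ} (f : β → α) (hf : f '' B = A)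
    (h : ∀ p ∈ B, ∀ q ∈ B, σ p q ≤ ε → ρ (f p) (f q) ≤ δ) :
    coveringNumber A ρ δ ≤ coveringNumber B σ ε := by
  subst hf
  refine le_sInf ?_
  rintro _ ⟨S, hSB, rfl, hS⟩
  refine sInf_le_of_le ⟨f '' S, Set.image_mono hSB, rfl, ?_⟩ (Set.encard_image_le f S)
  rintro _ ⟨p, hp, rfl⟩
  obtain ⟨q, hq, hpq⟩ := hS p hp
  exact ⟨f q, Set.mem_image_of_mem f hq, h p hp q (hSB hq) hpq⟩

theorem abs_sqrt_sub_sqrt_le (a b : ℝ) : |√a - √b| ≤ √|a - b| := by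
  wlog hab : b ≤ a generalizing a b
  · rw [abs_sub_comm, abs_sub_comm a b]
    exact this b a (le_of_not_ge hab)
  rw [abs_of_nonneg (sub_nonneg.2 (sqrt_le_sqrt hab)), abs_of_nonneg (sub_nonneg.2 hab)]
  rcases le_total 0 b with hb | hb
  · rw [sub_le_iff_le_add]
    refine sqrt_le_iff.2 ⟨by positivity, ?_⟩
    nlinarith [sq_sqrt (sub_nonneg.2 hab), sq_sqrt hb,
      mul_nonneg (sqrt_nonneg (a - b)) (sqrt_nonneg b)]
  · rw [sqrt_eq_zero_of_nonpos hb, sub_zero]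
    exact sqrt_le_sqrt (by linarith)

theorem abs_exp_neg_sub_exp_neg_le {u v : ℝ} (hu : 0 ≤ u) (hv : 0 ≤ v) :
    |exp (-u) - exp (-v)| ≤ |u - v| := by
  wlog huv : u ≤ v generalizing u v
  · rw [abs_sub_comm, abs_sub_comm u v]
    exact this hv hu (le_of_not_ge huv)
  rw [abs_of_nonneg (sub_nonneg.2 (exp_le_exp.2 (neg_le_neg huv))), abs_sub_comm,
    abs_of_nonneg (sub_nonneg.2 huv)]
  have h1 : exp (-v) = exp (-u) * exp (-(v - u)) := by rw [← exp_add]; ring_nf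
  have h2 := add_one_le_exp (-(v - u))
  have h3 : exp (-u) ≤ 1 := exp_le_one_iff.2 (by linarith)
  nlinarith [exp_pos (-u)]

theorem abs_sqrt_one_sub_exp_sub_le {s t : ℝ} (hs : 0 ≤ s) (ht : 0 ≤ t) :
    |√(1 - exp (-2 * s)) - √(1 - exp (-2 * t))| ≤ √2 * √|s - t| := by
  refine (abs_sqrt_sub_sqrt_le _ _).trans ?_
  rw [← sqrt_mul (by norm_num)]
  refine sqrt_le_sqrt ?_
  have h := abs_exp_neg_sub_exp_neg_le (u := 2 * t) (v := 2 * s) (by linarith) (by linarith)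
  rw [← mul_sub, abs_mul, abs_two, abs_sub_comm t s] at h
  calc |1 - exp (-2 * s) - (1 - exp (-2 * t))| = |exp (-(2 * t)) - exp (-(2 * s))| := by
        ring_nf
    _ ≤ 2 * |s - t| := h

theorem abs_sub_le_of_lipschitzWith {E : Type*} [NormedAddCommGroup E] [NormedSpace ℝ E]
    {L : ℝ≥0} {g : E → ℝ} (hg : LipschitzWith L g) {s t : ℝ} (hs : 0 ≤ s) (ht : 0 ≤ t)
    (x y z : E) :
    |g (exp (-s) • x + √(1 - exp (-2 * s)) • z) - g (exp (-t) • y + √(1 - exp (-2 * t)) • z)|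
      ≤ L * (‖exp (-s) • x - exp (-t) • y‖ + √2 * √|s - t| * ‖z‖) := by
  rw [← Real.dist_eq]
  refine (hg.dist_le_mul _ _).trans (mul_le_mul_of_nonneg_left ?_ L.2)
  rw [dist_eq_norm, add_sub_add_comm, ← sub_smul]
  refine (norm_add_le _ _).trans ?_
  rw [norm_smul, Real.norm_eq_abs]
  gcongr
  exact abs_sqrt_one_sub_exp_sub_le hs ht

theorem sqrt_integral_sq_le_of_abs_le {E : Type*} [NormedAddCommGroup E] [MeasurableSpace E]
    {Q : Measure E} [IsProbabilityMeasure Q] (hQ : Integrable (fun z => ‖z‖ ^ 2) Q)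
    {f : E → ℝ} {K a b : ℝ} (hK : 0 ≤ K) (ha : 0 ≤ a) (hb : 0 ≤ b)
    (hf : ∀ z, |f z| ≤ K * (a + √2 * b * ‖z‖)) :
    √(∫ z, f z ^ 2 ∂Q) ≤ K * (1 + √2 * √(∫ z, ‖z‖ ^ 2 ∂Q)) * (a + b) := by
  have h2 : √2 ^ 2 = (2 : ℝ) := sq_sqrt (by norm_num)
  have hM : √(∫ z, ‖z‖ ^ 2 ∂Q) ^ 2 = ∫ z, ‖z‖ ^ 2 ∂Q :=
    sq_sqrt (integral_nonneg fun z => by positivity)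
  set M := √(∫ z, ‖z‖ ^ 2 ∂Q)
  have hM0 : 0 ≤ M := sqrt_nonneg _
  have hpt : ∀ z, f z ^ 2 ≤ K ^ 2 * (a + b) ^ 2 * (1 + 2 * ‖z‖ ^ 2) := fun z => by
    have hcs : (a + √2 * b * ‖z‖) ^ 2 ≤ (a + b) ^ 2 * (1 + 2 * ‖z‖ ^ 2) := by
      have h3 : 2 * ‖z‖ ^ 2 = (√2 * ‖z‖) ^ 2 := by rw [mul_pow, h2]
      rw [h3]
      nlinarith [sq_nonneg (b - √2 * a * ‖z‖), mul_nonneg ha hb,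
        mul_nonneg (mul_nonneg ha hb) (sq_nonneg (√2 * ‖z‖))]
    calc f z ^ 2 = |f z| ^ 2 := (sq_abs _).symm
      _ ≤ (K * (a + √2 * b * ‖z‖)) ^ 2 := pow_le_pow_left₀ (abs_nonneg _) (hf z) 2
      _ = K ^ 2 * (a + √2 * b * ‖z‖) ^ 2 := mul_pow _ _ _
      _ ≤ K ^ 2 * ((a + b) ^ 2 * (1 + 2 * ‖z‖ ^ 2)) := by gcongr
      _ = _ := by ring
  have hint : Integrable (fun z => 1 + 2 * ‖z‖ ^ 2) Q :=
    (integrable_const (1 : ℝ)).add (hQ.const_mul 2)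
  have heq : ∫ z, (1 + 2 * ‖z‖ ^ 2) ∂Q = 1 + 2 * M ^ 2 := by
    rw [integral_add (integrable_const _) (hQ.const_mul 2), integral_const_mul, hM]
    simp
  refine sqrt_le_iff.2 ⟨by positivity, ?_⟩
  calc ∫ z, f z ^ 2 ∂Q ≤ ∫ z, K ^ 2 * (a + b) ^ 2 * (1 + 2 * ‖z‖ ^ 2) ∂Q :=
        integral_mono_of_nonneg (.of_forall fun z => sq_nonneg _) (hint.const_mul _)
          (.of_forall hpt)
    _ = K ^ 2 * (a + b) ^ 2 * (1 + √2 ^ 2 * M ^ 2) := by rw [integral_const_mul, heq, h2]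
    _ ≤ K ^ 2 * (a + b) ^ 2 * (1 + √2 * M) ^ 2 := by
        gcongr
        nlinarith [mul_nonneg (sqrt_nonneg 2) hM0]
    _ = _ := by ring

/-- If `A` is a finite `ε`-net of `[0,T] × B^d(R)` for `ρ_OU`, then
`{ḡ_{t,x} : (t,x) ∈ A}` is a `(Cε)`-net of `G = {ḡ_{t,x}}` in `L²(Q)`, where
`C = L(1 + √2 ‖z‖_{L²(Q)})`; consequently
`N(G, L²(Q), Cε) ≤ N([0,T] × B^d(R), ρ_OU, ε)`. -/
theorem stmt_8 (d : ℕ) (hd : 1 ≤ d)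
    (L : ℝ≥0) (g : EuclideanSpace ℝ (Fin d) → ℝ) (hg : LipschitzWith L g)
    (Q : Measure (EuclideanSpace ℝ (Fin d))) [IsProbabilityMeasure Q]
    (hQ : Integrable (fun z => ‖z‖ ^ 2) Q)
    (T R : ℝ) (hT : 0 < T) (hR : 0 < R)
    (C : ℝ) (hC : C = L * (1 + Real.sqrt 2 * Real.sqrt (∫ z, ‖z‖ ^ 2 ∂Q)))
    (gbar : ℝ → EuclideanSpace ℝ (Fin d) → EuclideanSpace ℝ (Fin d) → ℝ)
    (hgbar : ∀ t x z, gbar t x z =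
      g (exp (-t) • x + Real.sqrt (1 - exp (-2 * t)) • z) - g 0)
    (ρOU : (ℝ × EuclideanSpace ℝ (Fin d)) → (ℝ × EuclideanSpace ℝ (Fin d)) → ℝ)
    (hρOU : ∀ p q, ρOU p q =
      ‖exp (-p.1) • p.2 - exp (-q.1) • q.2‖ + Real.sqrt |p.1 - q.1|)
    (distL2 : (EuclideanSpace ℝ (Fin d) → ℝ) → (EuclideanSpace ℝ (Fin d) → ℝ) → ℝ)
    (hdistL2 : ∀ h h', distL2 h h' = Real.sqrt (∫ z, (h z - h' z) ^ 2 ∂Q))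
    (G : Set (EuclideanSpace ℝ (Fin d) → ℝ))
    (hG : G = {h | ∃ t ∈ Set.Icc (0 : ℝ) T,
      ∃ x ∈ Metric.closedBall (0 : EuclideanSpace ℝ (Fin d)) R, h = gbar t x})
    (ε : ℝ) (hε : 0 < ε)
    (A : Set (ℝ × EuclideanSpace ℝ (Fin d))) (hA_fin : A.Finite)
    (hA_sub : A ⊆ Set.Icc (0 : ℝ) T ×ˢ Metric.closedBall (0 : EuclideanSpace ℝ (Fin d)) R)
    (hA_net : ∀ p ∈ Set.Icc (0 : ℝ) T ×ˢ
        Metric.closedBall (0 : EuclideanSpace ℝ (Fin d)) R, ∃ a ∈ A, ρOU p a ≤ ε) :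
    (∀ h ∈ G, ∃ a ∈ A, distL2 h (gbar a.1 a.2) ≤ C * ε) ∧
      coveringNumber G distL2 (C * ε) ≤
        coveringNumber
          (Set.Icc (0 : ℝ) T ×ˢ Metric.closedBall (0 : EuclideanSpace ℝ (Fin d)) R)
          ρOU ε := by
  have key : ∀ p ∈ Set.Icc (0 : ℝ) T ×ˢ Metric.closedBall (0 : EuclideanSpace ℝ (Fin d)) R,
      ∀ q ∈ Set.Icc (0 : ℝ) T ×ˢ Metric.closedBall (0 : EuclideanSpace ℝ (Fin d)) R,
      ρOU p q ≤ ε → distL2 (gbar p.1 p.2) (gbar q.1 q.2) ≤ C * ε := by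
    intro p hp q hq hpq
    rw [hρOU] at hpq
    rw [hdistL2, hC]
    refine (sqrt_integral_sq_le_of_abs_le hQ L.2 (norm_nonneg _) (sqrt_nonneg _)
      fun z => ?_).trans (mul_le_mul_of_nonneg_left hpq
        (mul_nonneg L.2 (by positivity)))
    rw [hgbar, hgbar, sub_sub_sub_cancel_right]
    exact abs_sub_le_of_lipschitzWith hg hp.1.1 hq.1.1 p.2 q.2 z
  constructor
  · intro h hh
    rw [hG] at hh
    obtain ⟨t, ht, x, hx, rfl⟩ := hh
    obtain ⟨a, ha, hρ⟩ := hA_net (t, x) ⟨ht, hx⟩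
    exact ⟨a, ha, key (t, x) ⟨ht, hx⟩ a (hA_sub ha) hρ⟩
  · refine coveringNumber_le_of_forall_mem_image (fun p => gbar p.1 p.2) ?_ key
    rw [hG]
    ext h
    constructor
    · rintro ⟨p, hp, rfl⟩
      exact ⟨p.1, hp.1, p.2, hp.2, rfl⟩
    · rintro ⟨t, ht, x, hx, rfl⟩
      exact ⟨(t, x), ⟨ht, hx⟩, rfl⟩
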